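/- Let ω ∈ ℝ and φ : 𝕋_1 → ℂ analytic with ‖φ'''‖_1 ≤ 1, and let f̄, ḡ be the functions with f(x,y) = y f̄(x,y), g(x,y) = y ḡ(x,y) for the adapted-coordinates solutions f, g. Then there is a universal constant C such that |f̄|^{(λ',2)} + |ḡ|^{(λ',2)} ≤ C for λ' = (1 − |φ'|)²/2, where |φ'| = sup_{𝕋_1}|φ'|. -/

import Mathlib

/-!
Statement 15 (Corollary bar-fg-Cr): the reduced adapted-coordinates data `f̄`, `ḡ`
satisfy a universal `C²` bound on the triangular domain `D_{λ'}`, `λ' = (1 − |φ'|)²/2`.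
-/

open Real Set ENNReal

noncomputable section

def strip (a : ℝ) : Set ℂ := {z : ℂ | |z.im| < a}

def Dtri (lam : ℝ) : Set (ℂ × ℂ) := {p : ℂ × ℂ | |p.1.im| + ‖p.2‖ / lam < 1}

def Per1 (u : ℂ → ℂ) : Prop := ∀ z, u (z + 1) = u z

def Per1' (u : ℂ × ℂ → ℂ) : Prop := ∀ z w, u (z + 1, w) = u (z, w)

def fcoeff (u : ℂ → ℂ) (k : ℤ) : ℂ :=
  ∫ t in (0:ℝ)..1, u (t : ℂ) * Complex.exp (-(2 * (π : ℂ) * Complex.I * (k : ℂ) * (t : ℂ)))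

def fwNormLE (u : ℂ → ℂ) (c : ℝ) : Prop :=
  Summable (fun k : ℤ => ‖fcoeff u k‖ * Real.exp (2 * π * |(k : ℝ)|)) ∧
    (∑' k : ℤ, ‖fcoeff u k‖ * Real.exp (2 * π * |(k : ℝ)|)) ≤ c

def pdx (u : ℂ × ℂ → ℂ) : ℂ × ℂ → ℂ := fun p => deriv (fun x => u (x, p.2)) p.1

def pdy (u : ℂ × ℂ → ℂ) : ℂ × ℂ → ℂ := fun p => deriv (fun y => u (p.1, y)) p.2

def triSup (lam : ℝ) (u : ℂ × ℂ → ℂ) : ℝ≥0∞ :=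
  ⨆ p ∈ Dtri lam, (‖u p‖₊ : ℝ≥0∞)

/-- The `C^r` "norm" `|u|^{(λ,r)}` on `D_λ`. -/
def triCr (lam : ℝ) (r : ℕ) (u : ℂ × ℂ → ℂ) : ℝ≥0∞ :=
  ⨆ (j : ℕ) (k : ℕ) (_ : j + k ≤ r), triSup lam (pdx^[j] (pdy^[k] u))

/-- `|φ'| = sup_{𝕋₁} |φ'|`. -/
def phiDerSup (φ : ℂ → ℂ) : ℝ :=
  sSup ((fun z => ‖deriv φ z‖) '' strip 1)

open scoped Topology in
lemma aux_strip_open : IsOpen (strip 1) := by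
  have : Continuous (fun z : ℂ => |z.im|) := Complex.continuous_im.abs
  exact isOpen_lt this continuous_const

lemma aux_strip_convex : Convex ℝ (strip 1) := by
  have h : strip 1 = Complex.imCLM ⁻¹' (Metric.ball (0:ℝ) 1) := by
    ext z; simp [strip]
  rw [h]
  exact (convex_ball _ _).linear_preimage Complex.imCLM.toLinearMap

lemma aux_real_mem (t : ℝ) : (t : ℂ) ∈ strip 1 := by simp [strip]

lemma aux_per_deriv {u : ℂ → ℂ} (h : Per1 u) : Per1 (deriv u) := by
  intro z
  have h1 : (fun w => u (w + 1)) = u := funext h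
  have h2 := deriv_comp_add_const (f := u) (a := (1:ℂ)) (x := z)
  rw [← h2, h1]

lemma aux_cont_real {u : ℂ → ℂ} (ha : AnalyticOnNhd ℂ u (strip 1)) :
    Continuous (fun t : ℝ => u (t : ℂ)) := by
  rw [continuous_iff_continuousAt]
  intro t
  exact ContinuousAt.comp (f := fun t : ℝ => (t:ℂ)) (g := u)
    (ha _ (aux_real_mem t)).continuousAt Complex.continuous_ofReal.continuousAt

lemma aux_fourier_real {u : ℂ → ℂ} (hp : Per1 u) (ha : AnalyticOnNhd ℂ u (strip 1))
    (hs : Summable (fun k : ℤ => ‖fcoeff u k‖)) (t : ℝ) :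
    HasSum (fun k : ℤ => fcoeff u k * Complex.exp (2 * (π : ℂ) * Complex.I * (k : ℂ) * (t : ℂ)))
      (u t) := by
  have hper : Function.Periodic (fun t : ℝ => u (t : ℂ)) 1 := by
    intro t
    have := hp (t : ℂ)
    simpa using this
  have hc := aux_cont_real ha
  let f : C(AddCircle (1:ℝ), ℂ) :=
    ⟨hper.lift, continuous_coinduced_dom.mpr hc⟩
  have hf : ∀ t : ℝ, f (t : AddCircle (1:ℝ)) = u t := fun t => rfl
  have hfc : ∀ k, fourierCoeff f k = fcoeff u k := by
    intro k
    rw [fourierCoeff_eq_intervalIntegral _ _ 0, fcoeff]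
    simp only [hf, fourier_coe_apply]
    simp only [zero_add, div_one, one_smul, smul_eq_mul, Complex.ofReal_one]
    refine intervalIntegral.integral_congr fun x _ => ?_
    rw [mul_comm]
    congr 2
    push_cast
    ring
  have hsum : Summable (fourierCoeff f) := by
    rw [funext hfc]
    exact hs.of_norm
  have := has_pointwise_sum_fourier_series_of_summable hsum (t : AddCircle (1:ℝ))
  simpa [hfc, hf, fourier_coe_apply] using this

lemma aux_norm_exp (k : ℤ) {z : ℂ} (hz : z ∈ strip 1) :
    ‖Complex.exp (2 * (π : ℂ) * Complex.I * (k : ℂ) * z)‖ ≤ Real.exp (2 * π * |(k:ℝ)|) := by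
  rw [Complex.norm_exp]
  apply Real.exp_le_exp.mpr
  have h1 : (2 * (π : ℂ) * Complex.I * (k : ℂ) * z).re = 2 * π * (-(k * z.im)) := by
    simp
    ring
  rw [h1]
  have hz' : |z.im| ≤ 1 := le_of_lt hz
  have h2 : -((k:ℝ) * z.im) ≤ |(k:ℝ)| := by
    calc -((k:ℝ) * z.im) ≤ |(k:ℝ) * z.im| := neg_le_abs _
      _ = |(k:ℝ)| * |z.im| := abs_mul _ _
      _ ≤ |(k:ℝ)| * 1 := by gcongr
      _ = _ := mul_one _
  have := Real.pi_pos
  gcongr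

open scoped Topology in
lemma aux_sup_bound {u : ℂ → ℂ} {c : ℝ} (hp : Per1 u) (ha : AnalyticOnNhd ℂ u (strip 1))
    (hu : fwNormLE u c) : ∀ z ∈ strip 1, ‖u z‖ ≤ c := by
  obtain ⟨hs, hle⟩ := hu
  have hbd : ∀ (k : ℤ) (z : ℂ), z ∈ strip 1 →
      ‖fcoeff u k * Complex.exp (2 * (π : ℂ) * Complex.I * (k : ℂ) * z)‖ ≤
        ‖fcoeff u k‖ * Real.exp (2 * π * |(k : ℝ)|) := by
    intro k z hz
    rw [norm_mul]
    gcongr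
    exact aux_norm_exp k hz
  have hs0 : Summable (fun k : ℤ => ‖fcoeff u k‖) := by
    refine Summable.of_nonneg_of_le (fun _ => norm_nonneg _) (fun k => ?_) hs
    refine le_mul_of_one_le_right (norm_nonneg _) (Real.one_le_exp ?_)
    have := Real.pi_pos
    positivity
  let S : ℂ → ℂ := fun z => ∑' k : ℤ,
    fcoeff u k * Complex.exp (2 * (π : ℂ) * Complex.I * (k : ℂ) * z)
  have hS : DifferentiableOn ℂ S (strip 1) :=
    Complex.differentiableOn_tsum_of_summable_norm hs
      (fun k => by fun_prop) aux_strip_open hbd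
  have hSa : AnalyticOnNhd ℂ S (strip 1) := hS.analyticOnNhd aux_strip_open
  have heq : EqOn u S (strip 1) := by
    refine ha.eqOn_of_preconnected_of_frequently_eq hSa
      aux_strip_convex.isPreconnected (z₀ := 0) (by simp [strip]) ?_
    have hR : ∀ t : ℝ, u t = S t := fun t => (aux_fourier_real hp ha hs0 t).tsum_eq.symm
    have ht : Filter.Tendsto (fun t : ℝ => (t : ℂ)) (𝓝[≠] 0) (𝓝[≠] 0) := by
      refine tendsto_nhdsWithin_iff.mpr ⟨?_, ?_⟩
      · have : Filter.Tendsto (fun t : ℝ => (t : ℂ)) (𝓝 0) (𝓝 ((0:ℝ):ℂ)) :=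
          Complex.continuous_ofReal.continuousAt
        simpa using this.mono_left nhdsWithin_le_nhds
      · filter_upwards [self_mem_nhdsWithin] with t ht
        simpa using ht
    exact ht.frequently (Filter.Eventually.frequently (Filter.Eventually.of_forall hR))
  intro z hz
  rw [heq hz]
  refine le_trans (tsum_of_norm_bounded hs.hasSum (fun k => hbd k z hz)) hle

lemma aux_hasDeriv_real {u : ℂ → ℂ} (ha : AnalyticOnNhd ℂ u (strip 1)) (t : ℝ) :
    HasDerivAt (fun t : ℝ => u (t:ℂ)) (deriv u t) t :=
  ((ha _ (aux_real_mem t)).differentiableAt.hasDerivAt).comp_ofReal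

lemma aux_fcoeff_deriv {u : ℂ → ℂ} (hp : Per1 u) (ha : AnalyticOnNhd ℂ u (strip 1)) (k : ℤ) :
    fcoeff (deriv u) k = (2 * (π : ℂ) * Complex.I * (k : ℂ)) * fcoeff u k := by
  have hd := ha.deriv
  unfold fcoeff
  have hE : ∀ t : ℝ, HasDerivAt
      (fun t : ℝ => Complex.exp (-(2 * (π : ℂ) * Complex.I * (k : ℂ) * (t : ℂ))))
      (-(2 * (π : ℂ) * Complex.I * (k : ℂ)) *
        Complex.exp (-(2 * (π : ℂ) * Complex.I * (k : ℂ) * (t : ℂ)))) t := by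
    intro t
    have h1 : HasDerivAt (fun z : ℂ => Complex.exp (-(2 * (π : ℂ) * Complex.I * (k : ℂ) * z)))
      (-(2 * (π : ℂ) * Complex.I * (k : ℂ)) *
        Complex.exp (-(2 * (π : ℂ) * Complex.I * (k : ℂ) * (t : ℂ)))) (t:ℂ) := by
      have := (((hasDerivAt_id (t:ℂ)).const_mul (2 * (π : ℂ) * Complex.I * (k : ℂ))).neg).cexp
      simpa [mul_comm] using this
    exact h1.comp_ofReal
  have hcE : Continuous (fun t : ℝ => Complex.exp (-(2 * (π : ℂ) * Complex.I * (k : ℂ) * (t : ℂ)))) := by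
    fun_prop
  have key := intervalIntegral.integral_mul_deriv_eq_deriv_mul (a := (0:ℝ)) (b := 1)
    (fun t _ => hE t) (fun t _ => aux_hasDeriv_real ha t)
    ((hcE.const_smul (-(2 * (π : ℂ) * Complex.I * (k : ℂ)))).intervalIntegrable 0 1)
    ((aux_cont_real hd).intervalIntegrable 0 1)
  have e1 : Complex.exp (-(2 * (π : ℂ) * Complex.I * (k : ℂ))) = 1 := by
    rw [Complex.exp_eq_one_iff]
    exact ⟨-k, by push_cast; ring⟩
  have hp0 : u 1 = u 0 := by simpa using hp 0
  simp only [Complex.ofReal_one, Complex.ofReal_zero, mul_one, mul_zero, neg_zero,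
    Complex.exp_zero, e1, hp0, sub_self, zero_sub] at key
  rw [← intervalIntegral.integral_const_mul]
  have h2 : (∫ t in (0:ℝ)..1, deriv u (t : ℂ) *
      Complex.exp (-(2 * (π : ℂ) * Complex.I * (k : ℂ) * (t : ℂ)))) =
      ∫ t in (0:ℝ)..1, Complex.exp (-(2 * (π : ℂ) * Complex.I * (k : ℂ) * (t : ℂ))) *
        deriv u (t : ℂ) := by
    congr 1; ext t; ring
  rw [h2, key, ← intervalIntegral.integral_neg]
  congr 1; ext t; ring

lemma aux_fw_integrate {v : ℂ → ℂ} {c : ℝ} (hp : Per1 v) (ha : AnalyticOnNhd ℂ v (strip 1))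
    (h : fwNormLE (deriv (deriv v)) c) : fwNormLE (deriv v) (c / 6) := by
  have hk : ∀ k : ℤ, ‖fcoeff (deriv v) k‖ ≤ ‖fcoeff (deriv (deriv v)) k‖ / 6 := by
    intro k
    rcases eq_or_ne k 0 with rfl | hk
    · rw [aux_fcoeff_deriv hp ha]
      simp
      positivity
    · rw [aux_fcoeff_deriv (aux_per_deriv hp) ha.deriv, norm_mul]
      have h1 : ‖(2 * (π : ℂ) * Complex.I * (k : ℂ))‖ = 2 * π * |(k:ℝ)| := by
        simp [abs_of_pos Real.pi_pos]
      rw [h1]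
      have h2 : (1:ℝ) ≤ |(k:ℝ)| := by
        rw [← Int.cast_abs]
        exact_mod_cast Int.one_le_abs hk
      have h3 := Real.pi_gt_three
      have h4 : (6:ℝ) ≤ 2 * π * |(k:ℝ)| := by nlinarith
      have h5 := norm_nonneg (fcoeff (deriv v) k)
      rw [le_div_iff₀ (by norm_num)]
      nlinarith
  obtain ⟨hs, hle⟩ := h
  have hb : ∀ k : ℤ, ‖fcoeff (deriv v) k‖ * Real.exp (2 * π * |(k : ℝ)|) ≤
      (‖fcoeff (deriv (deriv v)) k‖ * Real.exp (2 * π * |(k : ℝ)|)) / 6 := by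
    intro k
    have := mul_le_mul_of_nonneg_right (hk k) (Real.exp_pos (2 * π * |(k : ℝ)|)).le
    linarith
  have hs' : Summable (fun k : ℤ => ‖fcoeff (deriv v) k‖ * Real.exp (2 * π * |(k : ℝ)|)) :=
    Summable.of_nonneg_of_le (fun _ => by positivity) hb (hs.div_const 6)
  refine ⟨hs', ?_⟩
  calc _ ≤ ∑' k : ℤ, (‖fcoeff (deriv (deriv v)) k‖ * Real.exp (2 * π * |(k : ℝ)|)) / 6 :=
        hs'.tsum_le_tsum hb (hs.div_const 6)
    _ = _ := tsum_div_const
    _ ≤ c / 6 := by gcongr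

lemma aux_phi_bounds {φ : ℂ → ℂ} (hp : Per1 φ) (ha : AnalyticOnNhd ℂ φ (strip 1))
    (h : fwNormLE (deriv^[3] φ) 1) :
    (∀ z ∈ strip 1, ‖deriv φ z‖ ≤ 1 / 36) ∧ (∀ z ∈ strip 1, ‖deriv (deriv φ) z‖ ≤ 1 / 6) ∧
    (∀ z ∈ strip 1, ‖deriv (deriv (deriv φ)) z‖ ≤ 1) := by
  have h3 : fwNormLE (deriv (deriv (deriv φ))) 1 := h
  have hp1 := aux_per_deriv hp
  have hp2 := aux_per_deriv hp1
  have h2 := aux_fw_integrate hp1 ha.deriv h3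
  have h1 := aux_fw_integrate hp ha h2
  refine ⟨?_, ?_, ?_⟩
  · intro z hz
    have := aux_sup_bound hp1 ha.deriv h1 z hz
    norm_num at this ⊢
    linarith
  · exact aux_sup_bound hp2 ha.deriv.deriv h2
  · exact aux_sup_bound (aux_per_deriv hp2) ha.deriv.deriv.deriv h3

open scoped Topology in
lemma aux_param {K K' : ℂ → ℝ → ℂ} {U : Set ℂ} (hU : IsOpen U)
    (hK : ContinuousOn (Function.uncurry K) (U ×ˢ Icc (0:ℝ) 1))
    (hK' : ContinuousOn (Function.uncurry K') (U ×ˢ Icc (0:ℝ) 1))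
    (hd : ∀ s ∈ U, ∀ t ∈ Icc (0:ℝ) 1, HasDerivAt (fun s => K s t) (K' s t) s)
    {s₀ : ℂ} (hs₀ : s₀ ∈ U) :
    HasDerivAt (fun s => ∫ t in (0:ℝ)..1, K s t) (∫ t in (0:ℝ)..1, K' s₀ t) s₀ := by
  obtain ⟨ε, hε, hsub⟩ := Metric.nhds_basis_closedBall.mem_iff.mp (hU.mem_nhds hs₀)
  have hcomp : IsCompact (Metric.closedBall s₀ ε ×ˢ Icc (0:ℝ) 1) :=
    (isCompact_closedBall s₀ ε).prod isCompact_Icc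
  obtain ⟨C, hC⟩ := hcomp.exists_bound_of_continuousOn (hK'.mono (prod_mono_left hsub))
  have hslice : ∀ (L : ℂ → ℝ → ℂ), ContinuousOn (Function.uncurry L) (U ×ˢ Icc (0:ℝ) 1) →
      ∀ s ∈ U, ContinuousOn (L s) (Icc (0:ℝ) 1) := by
    intro L hL s hs
    exact hL.comp (f := fun t : ℝ => (s, t)) (by fun_prop) (fun t ht => ⟨hs, ht⟩)
  have hI : Set.uIoc (0:ℝ) 1 ⊆ Icc (0:ℝ) 1 := by
    rw [uIoc_of_le zero_le_one]; exact Ioc_subset_Icc_self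
  have hmeas : ∀ (L : ℂ → ℝ → ℂ), ContinuousOn (Function.uncurry L) (U ×ˢ Icc (0:ℝ) 1) →
      ∀ s ∈ U, MeasureTheory.AEStronglyMeasurable (L s)
        (MeasureTheory.volume.restrict (Set.uIoc (0:ℝ) 1)) := by
    intro L hL s hs
    exact ((hslice L hL s hs).mono hI).aestronglyMeasurable measurableSet_uIoc
  refine (intervalIntegral.hasDerivAt_integral_of_dominated_loc_of_deriv_le
    (bound := fun _ => C) (F := K) (F' := K')
    (Metric.closedBall_mem_nhds s₀ hε) ?_ ?_ ?_ ?_ ?_ ?_).2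
  · filter_upwards [hU.mem_nhds hs₀] with s hs using hmeas K hK s hs
  · refine ContinuousOn.intervalIntegrable ?_
    rw [uIcc_of_le zero_le_one]
    exact hslice K hK s₀ hs₀
  · exact hmeas K' hK' s₀ hs₀
  · exact Filter.Eventually.of_forall fun t ht s hs => hC (s, t) ⟨hs, hI ht⟩
  · exact intervalIntegrable_const
  · exact Filter.Eventually.of_forall fun t ht s hs => hd s (hsub hs) t (hI ht)

/-- averaged value along a segment -/
def auxQ (ψ : ℂ → ℂ) (b h : ℂ) : ℂ := ∫ t in (0:ℝ)..1, ψ (b + t * h)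

lemma aux_seg {b h : ℂ} (hb : b ∈ strip 1) (hbh : b + h ∈ strip 1) {t : ℝ}
    (ht : t ∈ Icc (0:ℝ) 1) : b + t * h ∈ strip 1 := by
  have := aux_strip_convex.add_smul_mem hb hbh ht
  simpa using this

lemma aux_int_bound {f : ℝ → ℂ} {C : ℝ} (h : ∀ t ∈ Icc (0:ℝ) 1, ‖f t‖ ≤ C) :
    ‖∫ t in (0:ℝ)..1, f t‖ ≤ C := by
  have := intervalIntegral.norm_integral_le_of_norm_le_const (a := (0:ℝ)) (b := 1) (f := f) (C := C)
    (fun t ht => h t (by rw [uIoc_of_le zero_le_one] at ht; exact Ioc_subset_Icc_self ht))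
  simpa using this

lemma auxQ_bound {ψ : ℂ → ℂ} {M : ℝ} (h0 : ∀ z ∈ strip 1, ‖ψ z‖ ≤ M) {b h : ℂ}
    (hb : b ∈ strip 1) (hbh : b + h ∈ strip 1) : ‖auxQ ψ b h‖ ≤ M :=
  aux_int_bound fun _ ht => h0 _ (aux_seg hb hbh ht)

lemma auxQ_zero (ψ : ℂ → ℂ) (b : ℂ) : auxQ ψ b 0 = ψ b := by simp [auxQ]

lemma auxQ_mul {φ : ℂ → ℂ} (ha : AnalyticOnNhd ℂ φ (strip 1)) {b h : ℂ}
    (hb : b ∈ strip 1) (hbh : b + h ∈ strip 1) :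
    h * auxQ (deriv φ) b h = φ (b + h) - φ b := by
  have hd : ∀ t ∈ uIcc (0:ℝ) 1, HasDerivAt (fun t : ℝ => φ (b + t * h))
      (h * deriv φ (b + t * h)) t := by
    intro t ht
    rw [uIcc_of_le zero_le_one] at ht
    have h1 := (ha _ (aux_seg hb hbh ht)).differentiableAt.hasDerivAt
    have h2 : HasDerivAt (fun z : ℂ => b + z * h) h (t : ℂ) := by
      simpa using ((hasDerivAt_id (t:ℂ)).mul_const h).const_add b
    have h3 := (HasDerivAt.comp (t:ℂ) (h₂ := φ) (h := fun z : ℂ => b + z * h) h1 h2).comp_ofReal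
    rw [mul_comm] at h3
    exact h3
  have hc : ContinuousOn (fun t : ℝ => h * deriv φ (b + t * h)) (uIcc (0:ℝ) 1) := by
    rw [uIcc_of_le zero_le_one]
    refine continuousOn_const.mul ?_
    exact ha.deriv.continuousOn.comp (f := fun t : ℝ => b + t * h) (by fun_prop)
      (fun t ht => aux_seg hb hbh ht)
  have := intervalIntegral.integral_eq_sub_of_hasDerivAt hd hc.intervalIntegrable
  rw [auxQ, ← intervalIntegral.integral_const_mul, this]
  simp

open scoped Topology in
lemma auxQ_jet {ψ b h : ℂ → ℂ} (hψ : AnalyticOnNhd ℂ ψ (strip 1))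
    (h1 : ∀ z ∈ strip 1, ‖deriv ψ z‖ ≤ 1 / 6)
    (h2 : ∀ z ∈ strip 1, ‖deriv (deriv ψ) z‖ ≤ 1)
    (hb : AnalyticAt ℂ b 0) (hh : AnalyticAt ℂ h 0)
    (hb0 : b 0 ∈ strip 1) (hbh0 : b 0 + h 0 ∈ strip 1) :
    AnalyticAt ℂ (fun s => auxQ ψ (b s) (h s)) 0 ∧
    ‖deriv (fun s => auxQ ψ (b s) (h s)) 0‖ ≤ 1 / 6 * (‖deriv b 0‖ + ‖deriv h 0‖) ∧
    ‖deriv (deriv (fun s => auxQ ψ (b s) (h s))) 0‖ ≤ (‖deriv b 0‖ + ‖deriv h 0‖) ^ 2 +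
      1 / 6 * (‖deriv (deriv b) 0‖ + ‖deriv (deriv h) 0‖) := by
  have hev : ∀ᶠ s in 𝓝 (0:ℂ), (AnalyticAt ℂ b s ∧ AnalyticAt ℂ h s) ∧
      (b s ∈ strip 1 ∧ b s + h s ∈ strip 1) :=
    (hb.eventually_analyticAt.and hh.eventually_analyticAt).and
      ((hb.continuousAt.eventually (aux_strip_open.mem_nhds hb0)).and
        ((hb.continuousAt.add hh.continuousAt).eventually (aux_strip_open.mem_nhds hbh0)))
  obtain ⟨U, hUP, hU, h0U⟩ := eventually_nhds_iff.mp hev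
  have hseg : ∀ s ∈ U, ∀ t ∈ Icc (0:ℝ) 1, b s + t * h s ∈ strip 1 := fun s hs t ht =>
    aux_seg (hUP s hs).2.1 (hUP s hs).2.2 ht
  have hba : AnalyticOnNhd ℂ b U := fun s hs => (hUP s hs).1.1
  have hha : AnalyticOnNhd ℂ h U := fun s hs => (hUP s hs).1.2
  have cfst : ∀ {g : ℂ → ℂ}, AnalyticOnNhd ℂ g U →
      ContinuousOn (fun p : ℂ × ℝ => g p.1) (U ×ˢ Icc (0:ℝ) 1) := fun hg =>
    hg.continuousOn.comp continuousOn_fst (fun p hp => hp.1)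
  have cT : ContinuousOn (fun p : ℂ × ℝ => (p.2 : ℂ)) (U ×ˢ Icc (0:ℝ) 1) := by fun_prop
  have cψ : ∀ {g : ℂ → ℂ}, AnalyticOnNhd ℂ g (strip 1) →
      ContinuousOn (fun p : ℂ × ℝ => g (b p.1 + p.2 * h p.1)) (U ×ˢ Icc (0:ℝ) 1) := fun hg =>
    hg.continuousOn.comp (f := fun p : ℂ × ℝ => b p.1 + p.2 * h p.1)
      ((cfst hba).add (cT.mul (cfst hha))) (fun p hp => hseg _ hp.1 _ hp.2)
  have dlin : ∀ s ∈ U, ∀ t : ℝ,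
      HasDerivAt (fun s => b s + t * h s) (deriv b s + t * deriv h s) s := fun s hs t =>
    (hba s hs).differentiableAt.hasDerivAt.add
      ((hha s hs).differentiableAt.hasDerivAt.const_mul (t:ℂ))
  have dlin' : ∀ s ∈ U, ∀ t : ℝ,
      HasDerivAt (fun s => deriv b s + t * deriv h s)
        (deriv (deriv b) s + t * deriv (deriv h) s) s := fun s hs t =>
    (hba.deriv s hs).differentiableAt.hasDerivAt.add
      ((hha.deriv s hs).differentiableAt.hasDerivAt.const_mul (t:ℂ))
  have dcomp : ∀ {g : ℂ → ℂ}, AnalyticOnNhd ℂ g (strip 1) → ∀ s ∈ U, ∀ t ∈ Icc (0:ℝ) 1,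
      HasDerivAt (fun s => g (b s + t * h s))
        (deriv g (b s + t * h s) * (deriv b s + t * deriv h s)) s := fun hg s hs t ht =>
    HasDerivAt.comp s (h := fun s => b s + t * h s)
      (hg _ (hseg s hs t ht)).differentiableAt.hasDerivAt (dlin s hs t)
  let K0 : ℂ → ℝ → ℂ := fun s t => ψ (b s + t * h s)
  let K1 : ℂ → ℝ → ℂ := fun s t =>
    deriv ψ (b s + t * h s) * (deriv b s + t * deriv h s)
  let K2 : ℂ → ℝ → ℂ := fun s t =>
    (deriv (deriv ψ) (b s + t * h s) * (deriv b s + t * deriv h s)) *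
      (deriv b s + t * deriv h s) +
    deriv ψ (b s + t * h s) * (deriv (deriv b) s + t * deriv (deriv h) s)
  have cl1 := (cfst hba.deriv).add (cT.mul (cfst hha.deriv))
  have cl2 := (cfst hba.deriv.deriv).add (cT.mul (cfst hha.deriv.deriv))
  have c0 : ContinuousOn (Function.uncurry K0) (U ×ˢ Icc (0:ℝ) 1) := cψ hψ
  have c1 : ContinuousOn (Function.uncurry K1) (U ×ˢ Icc (0:ℝ) 1) := (cψ hψ.deriv).mul cl1
  have c2 : ContinuousOn (Function.uncurry K2) (U ×ˢ Icc (0:ℝ) 1) :=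
    (((cψ hψ.deriv.deriv).mul cl1).mul cl1).add ((cψ hψ.deriv).mul cl2)
  have D0 : ∀ s ∈ U, HasDerivAt (fun s => auxQ ψ (b s) (h s)) (∫ t in (0:ℝ)..1, K1 s t) s :=
    fun s hs => aux_param hU c0 c1 (fun s hs t ht => dcomp hψ s hs t ht) hs
  have D1 : ∀ s ∈ U, HasDerivAt (fun s => ∫ t in (0:ℝ)..1, K1 s t) (∫ t in (0:ℝ)..1, K2 s t) s :=
    fun s hs => aux_param hU c1 c2
      (fun s hs t ht => (dcomp hψ.deriv s hs t ht).mul (dlin' s hs t)) hs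
  have hlinb : ∀ (x y : ℂ), ∀ t ∈ Icc (0:ℝ) 1, ‖x + t * y‖ ≤ ‖x‖ + ‖y‖ := by
    intro x y t ht
    refine (norm_add_le _ _).trans ?_
    gcongr
    rw [norm_mul, Complex.norm_real, Real.norm_of_nonneg ht.1]
    exact mul_le_of_le_one_left (norm_nonneg _) ht.2
  refine ⟨?_, ?_, ?_⟩
  · have : DifferentiableOn ℂ (fun s => auxQ ψ (b s) (h s)) U := fun s hs =>
      (D0 s hs).differentiableAt.differentiableWithinAt
    exact this.analyticAt (hU.mem_nhds h0U)
  · rw [(D0 0 h0U).deriv]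
    refine aux_int_bound fun t ht => ?_
    simp only [K1]
    rw [norm_mul]
    exact mul_le_mul (h1 _ (hseg 0 h0U t ht)) (hlinb _ _ t ht) (norm_nonneg _) (by norm_num)
  · have he : deriv (fun s => auxQ ψ (b s) (h s)) =ᶠ[𝓝 0] fun s => ∫ t in (0:ℝ)..1, K1 s t := by
      filter_upwards [hU.mem_nhds h0U] with s hs using (D0 s hs).deriv
    rw [he.deriv_eq, (D1 0 h0U).deriv]
    refine aux_int_bound fun t ht => ?_
    simp only [K2]
    refine (norm_add_le _ _).trans ?_
    rw [norm_mul, norm_mul, norm_mul]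
    have l1 := hlinb (deriv b 0) (deriv h 0) t ht
    have l2 := hlinb (deriv (deriv b) 0) (deriv (deriv h) 0) t ht
    have l3 := h2 _ (hseg 0 h0U t ht)
    have l4 := h1 _ (hseg 0 h0U t ht)
    have n1 := norm_nonneg (deriv b 0 + t * deriv h 0)
    refine add_le_add ?_ ?_
    · rw [sq]
      refine mul_le_mul ?_ l1 n1 (by positivity)
      calc _ ≤ 1 * (‖deriv b 0‖ + ‖deriv h 0‖) := mul_le_mul l3 l1 n1 (by norm_num)
        _ = _ := one_mul _
    · exact mul_le_mul l4 l2 (norm_nonneg _) (by norm_num)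

/-- second order jet bounds at the origin -/
def AuxJ (u : ℂ → ℂ) (a b c : ℝ) : Prop :=
  AnalyticAt ℂ u 0 ∧ ‖u 0‖ ≤ a ∧ ‖deriv u 0‖ ≤ b ∧ ‖deriv (deriv u) 0‖ ≤ c

open scoped Topology in
lemma aux_deriv_mul {u v : ℂ → ℂ} (hu : AnalyticAt ℂ u 0) (hv : AnalyticAt ℂ v 0) :
    deriv (fun s => u s * v s) 0 = deriv u 0 * v 0 + u 0 * deriv v 0 ∧
    deriv (deriv (fun s => u s * v s)) 0 =
      deriv (deriv u) 0 * v 0 + 2 * (deriv u 0 * deriv v 0) + u 0 * deriv (deriv v) 0 := by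
  have h1 : ∀ {s}, AnalyticAt ℂ u s → AnalyticAt ℂ v s →
      deriv (fun s => u s * v s) s = deriv u s * v s + u s * deriv v s := fun hu hv =>
    (hu.differentiableAt.hasDerivAt.mul hv.differentiableAt.hasDerivAt).deriv
  refine ⟨h1 hu hv, ?_⟩
  have he : deriv (fun s => u s * v s) =ᶠ[𝓝 0] fun s => deriv u s * v s + u s * deriv v s := by
    filter_upwards [hu.eventually_analyticAt, hv.eventually_analyticAt] with s a b using h1 a b
  rw [he.deriv_eq]
  have hu0 := hu.differentiableAt.hasDerivAt
  have hv0 := hv.differentiableAt.hasDerivAt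
  have hu1 := hu.deriv.differentiableAt.hasDerivAt
  have hv1 := hv.deriv.differentiableAt.hasDerivAt
  have := ((hu1.mul hv0).add (hu0.mul hv1)).deriv
  refine Eq.trans this ?_
  ring

lemma AuxJ.mul {u v : ℂ → ℂ} {a b c a' b' c' : ℝ} (hu : AuxJ u a b c) (hv : AuxJ v a' b' c') :
    AuxJ (fun s => u s * v s) (a * a') (b * a' + a * b') (c * a' + 2 * (b * b') + a * c') := by
  obtain ⟨hu, u0, u1, u2⟩ := hu
  obtain ⟨hv, v0, v1, v2⟩ := hv
  obtain ⟨e1, e2⟩ := aux_deriv_mul hu hv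
  have pa := (norm_nonneg _).trans u0
  have pb := (norm_nonneg _).trans u1
  have pc := (norm_nonneg _).trans u2
  have M : ∀ {x y : ℂ} {X Y : ℝ}, ‖x‖ ≤ X → ‖y‖ ≤ Y → 0 ≤ X → ‖x * y‖ ≤ X * Y := by
    intro x y X Y hx hy hX
    rw [norm_mul]
    exact mul_le_mul hx hy (norm_nonneg _) hX
  refine ⟨hu.mul hv, M u0 v0 pa, ?_, ?_⟩
  · rw [e1]
    exact (norm_add_le _ _).trans (add_le_add (M u1 v0 pb) (M u0 v1 pa))
  · rw [e2]
    refine (norm_add₃_le).trans (add_le_add (add_le_add (M u2 v0 pc) ?_) (M u0 v2 pa))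
    rw [norm_mul]
    simpa using M u1 v1 pb

lemma AuxJ.mono {u : ℂ → ℂ} {a b c a' b' c' : ℝ} (hu : AuxJ u a b c) (h1 : a ≤ a') (h2 : b ≤ b')
    (h3 : c ≤ c') : AuxJ u a' b' c' :=
  ⟨hu.1, hu.2.1.trans h1, hu.2.2.1.trans h2, hu.2.2.2.trans h3⟩

open scoped Topology in
lemma AuxJ.congr {u v : ℂ → ℂ} {a b c : ℝ} (hu : AuxJ u a b c) (h : v =ᶠ[𝓝 0] u) :
    AuxJ v a b c := by
  refine ⟨hu.1.congr h.symm, ?_, ?_, ?_⟩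
  · rw [h.eq_of_nhds]; exact hu.2.1
  · rw [h.deriv_eq]; exact hu.2.2.1
  · rw [h.deriv.deriv_eq]; exact hu.2.2.2

lemma AuxJ.const_add {u : ℂ → ℂ} {a b c : ℝ} (hu : AuxJ u a b c) (k : ℂ) :
    AuxJ (fun s => k + u s) (‖k‖ + a) b c := by
  have h : deriv (fun s => k + u s) = deriv u := by ext s; simp
  refine ⟨analyticAt_const.add hu.1, ?_, ?_, ?_⟩
  · exact (norm_add_le _ _).trans (by gcongr; exact hu.2.1)
  · rw [h]; exact hu.2.2.1
  · rw [h]; exact hu.2.2.2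

lemma aux_affine (x α : ℂ) (hα : ‖α‖ ≤ 1) : AuxJ (fun s => x + s * α) ‖x‖ 1 0 := by
  have h : deriv (fun s : ℂ => x + s * α) = fun _ => α := by
    ext s; simp
  refine ⟨by fun_prop, by simp, ?_, ?_⟩
  · rw [h]; exact hα
  · rw [h]; simp

/-- jets of averaged `1 + φ'` -/
lemma aux_QJ {ψ b h : ℂ → ℂ} (hψ : AnalyticOnNhd ℂ ψ (strip 1))
    (h0 : ∀ z ∈ strip 1, ‖ψ z‖ ≤ 1 / 36)
    (h1 : ∀ z ∈ strip 1, ‖deriv ψ z‖ ≤ 1 / 6)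
    (h2 : ∀ z ∈ strip 1, ‖deriv (deriv ψ) z‖ ≤ 1)
    {a0 a1 a2 c0 c1 c2 : ℝ}
    (hb : AuxJ b a0 a1 a2) (hh : AuxJ h c0 c1 c2)
    (hb0 : b 0 ∈ strip 1) (hbh0 : b 0 + h 0 ∈ strip 1) :
    AuxJ (fun s => 1 + auxQ ψ (b s) (h s)) (37 / 36) (1 / 6 * (a1 + c1))
      ((a1 + c1) ^ 2 + 1 / 6 * (a2 + c2)) := by
  obtain ⟨q0, q1, q2⟩ := auxQ_jet hψ h1 h2 hb.1 hh.1 hb0 hbh0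
  obtain ⟨-, -, b1, b2⟩ := hb
  obtain ⟨-, -, g1, g2⟩ := hh
  have : AuxJ (fun s => auxQ ψ (b s) (h s)) (1 / 36) (1 / 6 * (a1 + c1))
      ((a1 + c1) ^ 2 + 1 / 6 * (a2 + c2)) := by
    refine ⟨q0, auxQ_bound h0 hb0 hbh0, q1.trans ?_, q2.trans ?_⟩
    · gcongr
    · gcongr
  exact (this.const_add 1).mono (by norm_num) le_rfl le_rfl

lemma aux_one_add_lower {q : ℂ} (h : ‖q‖ ≤ 1 / 36) : 35 / 36 ≤ ‖1 + q‖ := by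
  have := norm_sub_norm_le (1:ℂ) (-q)
  simp only [norm_one, norm_neg, sub_neg_eq_add] at this
  linarith

lemma aux_zeroJ : AuxJ (fun _ => 0) 0 0 0 := by
  have h : deriv (fun _ : ℂ => (0:ℂ)) = fun _ => 0 := by ext s; simp
  refine ⟨analyticAt_const, by simp, by simp, ?_⟩
  rw [h]; simp

open scoped Topology in
lemma aux_curve {φ : ℂ → ℂ} (ha : AnalyticOnNhd ℂ φ (strip 1))
    (b1 : ∀ z ∈ strip 1, ‖deriv φ z‖ ≤ 1 / 36)
    (b2 : ∀ z ∈ strip 1, ‖deriv (deriv φ) z‖ ≤ 1 / 6)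
    (b3 : ∀ z ∈ strip 1, ‖deriv (deriv (deriv φ)) z‖ ≤ 1)
    {F G : ℂ → ℂ} {x y α β w : ℂ} (hα : ‖α‖ ≤ 1) (hβ : ‖β‖ ≤ 1) (hy : ‖y‖ ≤ 1)
    (hF : AnalyticAt ℂ F 0)
    (m1 : x ∈ strip 1) (m2 : x + y * F 0 ∈ strip 1) (m3 : x + w ∈ strip 1)
    (m4 : x + w + y * F 0 ∈ strip 1)
    (hE : ∀ᶠ s in 𝓝 (0:ℂ), F s * (1 + deriv φ (x + s * α)) *
      (1 + auxQ (deriv φ) (x + w + s * α) ((y + s * β) * F s)) = 1)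
    (hG : ∀ᶠ s in 𝓝 (0:ℂ), G s = F s *
      (1 + auxQ (deriv φ) (x + s * α) ((y + s * β) * F s)) *
      (1 + deriv φ (x + w + s * α + (y + s * β) * F s))) :
    AuxJ F 2 1 40 ∧ AuxJ G 8 12 400 := by
  have JX := aux_affine x α hα
  have JW := aux_affine (x + w) α hα
  have JY := (aux_affine y β hβ).mono hy le_rfl le_rfl
  have JP := aux_QJ ha.deriv b1 b2 b3 JX aux_zeroJ (by simpa using m1) (by simpa using m1)
  simp only [auxQ_zero] at JP
  have JF0 : AuxJ F ‖F 0‖ ‖deriv F 0‖ ‖deriv (deriv F) 0‖ := ⟨hF, le_rfl, le_rfl, le_rfl⟩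
  have JH0 := JY.mul JF0
  have JR0 := aux_QJ ha.deriv b1 b2 b3 JW JH0 (by simpa using m3) (by simpa using m4)
  -- the triple product is constant
  have hPl : 35 / 36 ≤ ‖1 + deriv φ (x + 0 * α)‖ := aux_one_add_lower (b1 _ (by simpa using m1))
  have hRl : 35 / 36 ≤ ‖1 + auxQ (deriv φ) (x + w + 0 * α) ((y + 0 * β) * F 0)‖ :=
    aux_one_add_lower (auxQ_bound b1 (by simpa using m3) (by simpa using m4))
  have hE0 := hE.self_of_nhds
  have hE' : (fun s => F s * (1 + deriv φ (x + s * α)) *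
      (1 + auxQ (deriv φ) (x + w + s * α) ((y + s * β) * F s))) =ᶠ[𝓝 0] fun _ => 1 := hE
  have d1 := hE'.deriv_eq
  have d2 := hE'.deriv.deriv_eq
  set P : ℂ → ℂ := fun s => 1 + deriv φ (x + s * α) with hP
  set R : ℂ → ℂ := fun s => 1 + auxQ (deriv φ) (x + w + s * α) ((y + s * β) * F s) with hR
  obtain ⟨e1, e2⟩ := aux_deriv_mul hF JP.1
  obtain ⟨e3, e4⟩ := aux_deriv_mul (hF.mul JP.1) JR0.1
  have d1' := e3.symm.trans d1
  have d2' := e4.symm.trans d2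
  have hc1 : deriv (fun _ : ℂ => (1:ℂ)) = fun _ => 0 := by ext s; simp
  rw [hc1] at d1' d2'
  rw [deriv_const] at d2'
  have e1' : deriv (F * P) 0 = deriv F 0 * P 0 + F 0 * deriv P 0 := e1
  have e2' : deriv (deriv (F * P)) 0 = deriv (deriv F) 0 * P 0 +
    2 * (deriv F 0 * deriv P 0) + F 0 * deriv (deriv P) 0 := e2
  rw [e1'] at d1' d2'
  rw [e2'] at d2'
  simp only [Pi.mul_apply] at d1' d2'
  obtain ⟨-, P0, P1, P2⟩ := JP
  obtain ⟨-, R0, R1, R2⟩ := JR0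
  have hE0n : ‖F 0‖ * ‖P 0‖ * ‖R 0‖ = 1 := by
    have := congrArg norm hE0
    rw [norm_mul, norm_mul, norm_one] at this
    exact this
  have hPl' : 35 / 36 ≤ ‖P 0‖ := hPl
  have hRl' : 35 / 36 ≤ ‖R 0‖ := hRl
  have f0n := norm_nonneg (F 0)
  have f1n := norm_nonneg (deriv F 0)
  have f2n := norm_nonneg (deriv (deriv F) 0)
  have hPR : 1225 / 1296 ≤ ‖P 0‖ * ‖R 0‖ := by nlinarith
  have hf0 : ‖F 0‖ ≤ 1.06 := by nlinarith
  have hdiv1 : deriv F 0 * (P 0 * R 0) = -(F 0 * deriv P 0 * R 0 + F 0 * P 0 * deriv R 0) := by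
    linear_combination d1'
  have hdiv2 : deriv (deriv F) 0 * (P 0 * R 0) = -(2 * (deriv F 0 * deriv P 0) * R 0 +
      F 0 * deriv (deriv P) 0 * R 0 + 2 * ((deriv F 0 * P 0 + F 0 * deriv P 0) * deriv R 0) +
      F 0 * P 0 * deriv (deriv R) 0) := by
    linear_combination d2'
  have M : ∀ {x y : ℂ} {X Y : ℝ}, ‖x‖ ≤ X → ‖y‖ ≤ Y → ‖x * y‖ ≤ X * Y := by
    intro x y X Y hx hy
    rw [norm_mul]
    exact mul_le_mul hx hy (norm_nonneg _) ((norm_nonneg _).trans hx)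
  have A : ∀ {x y : ℂ} {X Y : ℝ}, ‖x‖ ≤ X → ‖y‖ ≤ Y → ‖x + y‖ ≤ X + Y := fun hx hy =>
    (norm_add_le _ _).trans (add_le_add hx hy)
  have T2 : ‖(2:ℂ)‖ ≤ 2 := by simp
  have hf1 : ‖deriv F 0‖ ≤ 1 := by
    have k := A (M (M hf0 P1) R0) (M (M hf0 P0) R1)
    rw [← norm_neg, ← hdiv1, norm_mul, norm_mul] at k
    nlinarith
  have hR1 : ‖deriv R 0‖ ≤ 0.52 := by linarith
  have hR2 : ‖deriv (deriv R) 0‖ ≤ 10 + 1 / 6 * (2 + ‖deriv (deriv F) 0‖) := by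
    have : (1 + (1 * ‖F 0‖ + 1 * ‖deriv F 0‖)) ^ 2 ≤ (3.06:ℝ) ^ 2 := by
      gcongr; linarith
    linarith
  have hf2 : ‖deriv (deriv F) 0‖ ≤ 40 := by
    have k := A (A (A (M (M T2 (M hf1 P1)) R0) (M (M hf0 P2) R0))
      (M T2 (M (A (M hf1 P0) (M hf0 P1)) hR1))) (M (M hf0 P0) hR2)
    rw [← norm_neg, ← hdiv2, norm_mul, norm_mul] at k
    nlinarith
  have JF : AuxJ F 1.06 1 40 := ⟨hF, hf0, hf1, hf2⟩
  refine ⟨JF.mono (by norm_num) le_rfl le_rfl, ?_⟩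
  have JH := JY.mul JF
  have JS := aux_QJ ha.deriv b1 b2 b3 JX JH (by simpa using m1) (by simpa using m2)
  have JB : AuxJ (fun s => x + w + s * α + (y + s * β) * F s) (‖x + w‖ + 1 * 1.06)
      (1 + (1 * 1.06 + 1 * 1)) (0 + (0 * 1.06 + 2 * (1 * 1) + 1 * 40)) := by
    obtain ⟨wa, w0, w1, w2⟩ := JW
    obtain ⟨u, u0, u1, u2⟩ := JH
    have hd : ∀ s, AnalyticAt ℂ F s → deriv (fun s => x + w + s * α + (y + s * β) * F s) s =
        deriv (fun s => x + w + s * α) s + deriv (fun s => (y + s * β) * F s) s := by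
      intro s hs
      refine deriv_fun_add ?_ ?_
      · fun_prop
      · have := hs.differentiableAt
        fun_prop
    refine ⟨wa.add u, A w0 u0, ?_, ?_⟩
    · rw [hd 0 hF]
      exact A w1 u1
    · have he : deriv (fun s => x + w + s * α + (y + s * β) * F s) =ᶠ[𝓝 0] fun s =>
        deriv (fun s => x + w + s * α) s + deriv (fun s => (y + s * β) * F s) s := by
        filter_upwards [hF.eventually_analyticAt] with s hs using hd s hs
      rw [he.deriv_eq, deriv_fun_add wa.deriv.differentiableAt u.deriv.differentiableAt]
      exact A w2 u2
  have JT := aux_QJ ha.deriv b1 b2 b3 JB aux_zeroJ (by simpa using m4) (by simpa using m4)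
  simp only [auxQ_zero] at JT
  refine (((JF.mul JS).mul JT).congr hG).mono ?_ ?_ ?_ <;> norm_num

lemma aux_pdx_eq {u : ℂ × ℂ → ℂ} {p : ℂ × ℂ} (hu : AnalyticAt ℂ u p) :
    pdx u p = fderiv ℂ u p (1, 0) := by
  have h : HasDerivAt (fun x : ℂ => ((x, p.2) : ℂ × ℂ)) (1, 0) p.1 :=
    (hasDerivAt_id p.1).prodMk (hasDerivAt_const _ _)
  exact (HasFDerivAt.comp_hasDerivAt (l := u) p.1 hu.differentiableAt.hasFDerivAt h).deriv

lemma aux_pdy_eq {u : ℂ × ℂ → ℂ} {p : ℂ × ℂ} (hu : AnalyticAt ℂ u p) :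
    pdy u p = fderiv ℂ u p (0, 1) := by
  have h : HasDerivAt (fun y : ℂ => ((p.1, y) : ℂ × ℂ)) (0, 1) p.2 :=
    (hasDerivAt_const _ _).prodMk (hasDerivAt_id p.2)
  exact (HasFDerivAt.comp_hasDerivAt (l := u) p.2 hu.differentiableAt.hasFDerivAt h).deriv

open scoped Topology in
lemma aux_pdx_congr {u v : ℂ × ℂ → ℂ} {p : ℂ × ℂ} (h : u =ᶠ[𝓝 p] v) : pdx u p = pdx v p := by
  have hc : ContinuousAt (fun x : ℂ => ((x, p.2) : ℂ × ℂ)) p.1 := by fun_prop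
  have : (fun x => u (x, p.2)) =ᶠ[𝓝 p.1] fun x => v (x, p.2) := hc.eventually h
  exact this.deriv_eq

open scoped Topology in
lemma aux_pdy_congr {u v : ℂ × ℂ → ℂ} {p : ℂ × ℂ} (h : u =ᶠ[𝓝 p] v) : pdy u p = pdy v p := by
  have hc : ContinuousAt (fun y : ℂ => ((p.1, y) : ℂ × ℂ)) p.2 := by fun_prop
  have : (fun y => u (p.1, y)) =ᶠ[𝓝 p.2] fun y => v (p.1, y) := hc.eventually h
  exact this.deriv_eq

lemma aux_fderiv_apply {u : ℂ × ℂ → ℂ} {p : ℂ × ℂ} (hu : AnalyticAt ℂ u p) (v w : ℂ × ℂ) :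
    AnalyticAt ℂ (fun q => fderiv ℂ u q v) p ∧
    fderiv ℂ (fun q => fderiv ℂ u q v) p w = fderiv ℂ (fderiv ℂ u) p w v := by
  have h1 : AnalyticAt ℂ (fderiv ℂ u) p := hu.fderiv
  refine ⟨?_, ?_⟩
  · exact ((ContinuousLinearMap.apply ℂ ℂ v).analyticAt _).comp h1
  · rw [fderiv_clm_apply h1.differentiableAt (differentiableAt_const _)]
    simp

open scoped Topology in
lemma aux_dir {u : ℂ × ℂ → ℂ} {p : ℂ × ℂ} (hu : AnalyticAt ℂ u p) (α β : ℂ) :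
    deriv (fun s => u (p.1 + s * α, p.2 + s * β)) 0 = fderiv ℂ u p (α, β) ∧
    deriv (deriv (fun s => u (p.1 + s * α, p.2 + s * β))) 0 =
      fderiv ℂ (fderiv ℂ u) p (α, β) (α, β) := by
  have hl : ∀ s : ℂ, HasDerivAt (fun s : ℂ => ((p.1 + s * α, p.2 + s * β) : ℂ × ℂ)) (α, β) s := by
    intro s
    have e1 : HasDerivAt (fun s : ℂ => p.1 + s * α) α s := by
      simpa using ((hasDerivAt_id s).mul_const α).const_add p.1
    have e2 : HasDerivAt (fun s : ℂ => p.2 + s * β) β s := by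
      simpa using ((hasDerivAt_id s).mul_const β).const_add p.2
    exact e1.prodMk e2
  have key : ∀ {w : ℂ × ℂ → ℂ} {s : ℂ}, AnalyticAt ℂ w (p.1 + s * α, p.2 + s * β) →
      deriv (fun s => w (p.1 + s * α, p.2 + s * β)) s =
        fderiv ℂ w (p.1 + s * α, p.2 + s * β) (α, β) := by
    intro w s hw
    exact (HasFDerivAt.comp_hasDerivAt (l := w) s hw.differentiableAt.hasFDerivAt (hl s)).deriv
  have h0 : ((p.1 + 0 * α, p.2 + 0 * β) : ℂ × ℂ) = p := by simp
  have hc : ContinuousAt (fun s : ℂ => ((p.1 + s * α, p.2 + s * β) : ℂ × ℂ)) 0 :=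
    (hl 0).continuousAt
  refine ⟨?_, ?_⟩
  · rw [key (by rw [h0]; exact hu), h0]
  · have hev : ∀ᶠ q in 𝓝 ((p.1 + 0 * α, p.2 + 0 * β) : ℂ × ℂ), AnalyticAt ℂ u q := by
      rw [h0]; exact hu.eventually_analyticAt
    have he : deriv (fun s => u (p.1 + s * α, p.2 + s * β)) =ᶠ[𝓝 0]
        fun s => (fun q => fderiv ℂ u q (α, β)) (p.1 + s * α, p.2 + s * β) := by
      filter_upwards [hc.eventually hev] with s hs using key hs
    obtain ⟨a1, a2⟩ := aux_fderiv_apply hu (α, β) (α, β)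
    rw [he.deriv_eq, key (w := fun q => fderiv ℂ u q (α, β)) (by rw [h0]; exact a1), h0, a2]

open scoped Topology in
lemma aux_partials {u : ℂ × ℂ → ℂ} {p : ℂ × ℂ} (hu : AnalyticAt ℂ u p) {N : ℝ}
    (h : ∀ α β : ℂ, ‖α‖ ≤ 1 → ‖β‖ ≤ 1 →
      AuxJ (fun s => u (p.1 + s * α, p.2 + s * β)) N N N)
    {j k : ℕ} (hjk : j + k ≤ 2) : ‖pdx^[j] (pdy^[k] u) p‖ ≤ 2 * N := by
  have n0 : ‖(0:ℂ)‖ ≤ 1 := by simp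
  have n1 : ‖(1:ℂ)‖ ≤ 1 := by simp
  have hx := h 1 0 n1 n0
  have hy := h 0 1 n0 n1
  have hxy := h 1 1 n1 n1
  obtain ⟨-, x0, x1, x2⟩ := hx
  obtain ⟨-, y0, y1, y2⟩ := hy
  obtain ⟨-, -, z1, z2⟩ := hxy
  rw [(aux_dir hu _ _).1] at x1 y1 z1
  rw [(aux_dir hu _ _).2] at x2 y2 z2
  have hN : 0 ≤ N := (norm_nonneg _).trans x0
  have ev := hu.eventually_analyticAt
  have ex : pdx u =ᶠ[𝓝 p] fun q => fderiv ℂ u q (1, 0) := by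
    filter_upwards [ev] with q hq using aux_pdx_eq hq
  have ey : pdy u =ᶠ[𝓝 p] fun q => fderiv ℂ u q (0, 1) := by
    filter_upwards [ev] with q hq using aux_pdy_eq hq
  have hxx : pdx (pdx u) p = fderiv ℂ (fderiv ℂ u) p (1, 0) (1, 0) := by
    obtain ⟨a1, a2⟩ := aux_fderiv_apply hu (1, 0) (1, 0)
    rw [aux_pdx_congr ex, aux_pdx_eq a1, a2]
  have hxy : pdx (pdy u) p = fderiv ℂ (fderiv ℂ u) p (1, 0) (0, 1) := by
    obtain ⟨a1, a2⟩ := aux_fderiv_apply hu (0, 1) (1, 0)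
    rw [aux_pdx_congr ey, aux_pdx_eq a1, a2]
  have hyy : pdy (pdy u) p = fderiv ℂ (fderiv ℂ u) p (0, 1) (0, 1) := by
    obtain ⟨a1, a2⟩ := aux_fderiv_apply hu (0, 1) (0, 1)
    rw [aux_pdy_congr ey, aux_pdy_eq a1, a2]
  have hsym : fderiv ℂ (fderiv ℂ u) p (1, 0) (0, 1) = fderiv ℂ (fderiv ℂ u) p (0, 1) (1, 0) := by
    have : IsSymmSndFDerivAt ℂ u p := ContDiffAt.isSymmSndFDerivAt_of_omega hu.contDiffAt
    exact this.eq _ _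
  have hpol : fderiv ℂ (fderiv ℂ u) p (1, 1) (1, 1) = fderiv ℂ (fderiv ℂ u) p (1, 0) (1, 0) +
      2 * fderiv ℂ (fderiv ℂ u) p (1, 0) (0, 1) + fderiv ℂ (fderiv ℂ u) p (0, 1) (0, 1) := by
    have e : ((1, 1) : ℂ × ℂ) = (1, 0) + (0, 1) := by simp
    rw [e]
    simp only [map_add, add_apply]
    rw [hsym]
    ring
  have hj : j ≤ 2 := by omega
  have hk : k ≤ 2 := by omega
  interval_cases j <;> interval_cases k <;> first | omega | skip
  · simp only [Function.iterate_zero, id]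
    simp at x0
    linarith
  · change ‖pdy u p‖ ≤ _
    rw [aux_pdy_eq hu]; linarith
  · change ‖pdy (pdy u) p‖ ≤ _
    rw [hyy]; linarith
  · change ‖pdx u p‖ ≤ _
    rw [aux_pdx_eq hu]; linarith
  · change ‖pdx (pdy u) p‖ ≤ _
    rw [hxy]
    have e : 2 * fderiv ℂ (fderiv ℂ u) p (1, 0) (0, 1) = fderiv ℂ (fderiv ℂ u) p (1, 1) (1, 1) -
      fderiv ℂ (fderiv ℂ u) p (1, 0) (1, 0) - fderiv ℂ (fderiv ℂ u) p (0, 1) (0, 1) := by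
      rw [hpol]; ring
    have e' := congrArg norm e
    rw [norm_mul] at e'
    have s1 := norm_sub_le (fderiv ℂ (fderiv ℂ u) p (1, 1) (1, 1) -
      fderiv ℂ (fderiv ℂ u) p (1, 0) (1, 0)) (fderiv ℂ (fderiv ℂ u) p (0, 1) (0, 1))
    have s2 := norm_sub_le (fderiv ℂ (fderiv ℂ u) p (1, 1) (1, 1))
      (fderiv ℂ (fderiv ℂ u) p (1, 0) (1, 0))
    have t2 : ‖(2:ℂ)‖ = 2 := by simp
    rw [t2] at e'
    linarith
  · change ‖pdx (pdx u) p‖ ≤ _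
    rw [hxx]; linarith

lemma aux_triCr {lam N : ℝ} {u : ℂ × ℂ → ℂ}
    (h : ∀ p ∈ Dtri lam, ∀ j k : ℕ, j + k ≤ 2 → ‖pdx^[j] (pdy^[k] u) p‖ ≤ N) :
    triCr lam 2 u ≤ ENNReal.ofReal N := by
  unfold triCr triSup
  refine iSup_le fun j => iSup_le fun k => iSup_le fun hjk => iSup₂_le fun p hp => ?_
  rw [← enorm_eq_nnnorm, ← ofReal_norm]
  exact ENNReal.ofReal_le_ofReal (h p hp j k hjk)

lemma aux_shift {z h : ℂ} {r : ℝ} (hr : |z.im| + r ≤ 1) (hh : ‖h‖ < r) (ω : ℝ) :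
    z + ω ∈ strip 1 ∧ z + h ∈ strip 1 ∧ z + ω + h ∈ strip 1 := by
  have h1 : |h.im| < r := (Complex.abs_im_le_norm h).trans_lt hh
  have h0 := abs_nonneg h.im
  have h2 := abs_add_le z.im h.im
  refine ⟨?_, ?_, ?_⟩
  · change |(z + ω).im| < 1
    simp
    linarith
  · change |(z + h).im| < 1
    rw [Complex.add_im]
    linarith
  · change |(z + ω + h).im| < 1
    simp
    linarith

lemma aux_D_slice {lam : ℝ} (hlam : 0 < lam) {p : ℂ × ℂ} (hp : p ∈ Dtri lam) {c : ℂ}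
    (hc : ‖c‖ ≤ 1) : (p.1, c * p.2) ∈ Dtri lam := by
  change |p.1.im| + ‖c * p.2‖ / lam < 1
  have hp' : |p.1.im| + ‖p.2‖ / lam < 1 := hp
  have : ‖c * p.2‖ ≤ ‖p.2‖ := by
    rw [norm_mul]
    exact mul_le_of_le_one_left (norm_nonneg _) hc
  have : ‖c * p.2‖ / lam ≤ ‖p.2‖ / lam := by gcongr
  linarith

lemma aux_D_open {lam : ℝ} : IsOpen (Dtri lam) := by
  have : Continuous (fun p : ℂ × ℂ => |p.1.im| + ‖p.2‖ / lam) := by fun_prop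
  exact isOpen_lt this continuous_const

/-- the a priori bound, by a continuity argument -/
lemma aux_apriori {φ : ℂ → ℂ} (ha : AnalyticOnNhd ℂ φ (strip 1)) {m : ℝ} (hm : m < 1)
    (hb : ∀ z ∈ strip 1, ‖deriv φ z‖ ≤ m) {F : ℂ × ℂ → ℂ} {ω : ℝ}
    (hF : ContinuousOn F (Dtri ((1 - m) ^ 2)))
    (hE : ∀ p ∈ Dtri ((1 - m) ^ 2), p.2 * F p =
      p.2 / (1 + deriv φ p.1) + φ (p.1 + ω) - φ (p.1 + ω + p.2 * F p))
    {p : ℂ × ℂ} (hp : p ∈ Dtri ((1 - m) ^ 2)) : ‖p.2 * F p‖ < 1 - |p.1.im| := by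
  have hlam : 0 < (1 - m) ^ 2 := by
    have : 0 < 1 - m := by linarith
    positivity
  have hm' : 0 < 1 - m := by linarith
  have step : ∀ q ∈ Dtri ((1 - m) ^ 2), ‖q.2 * F q‖ < 1 - |q.1.im| →
      ‖q.2 * F q‖ ≤ ‖q.2‖ / (1 - m) ^ 2 := by
    intro q hq hlt
    obtain ⟨s1, s2, s3⟩ := aux_shift (z := q.1) (r := 1 - |q.1.im|) (by linarith) hlt ω
    have hq1 : q.1 ∈ strip 1 := by
      change |q.1.im| < 1
      have := norm_nonneg (q.2 * F q)
      linarith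
    have hlip := Convex.norm_image_sub_le_of_norm_deriv_le
      (fun z hz => (ha z hz).differentiableAt) hb aux_strip_convex s1 s3
    rw [add_sub_cancel_left] at hlip
    have hd : 1 - m ≤ ‖1 + deriv φ q.1‖ := by
      have := norm_sub_norm_le (1:ℂ) (-deriv φ q.1)
      simp only [norm_one, norm_neg, sub_neg_eq_add] at this
      have := hb _ hq1
      linarith
    have e : q.2 / (1 + deriv φ q.1) = q.2 * F q +
        (φ (q.1 + ω + q.2 * F q) - φ (q.1 + ω)) := by
      linear_combination -(hE q hq)
    have n1 : ‖q.2 * F q‖ - m * ‖q.2 * F q‖ ≤ ‖q.2 / (1 + deriv φ q.1)‖ := by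
      rw [e]
      have := norm_sub_norm_le (q.2 * F q) (-(φ (q.1 + ω + q.2 * F q) - φ (q.1 + ω)))
      rw [sub_neg_eq_add, norm_neg] at this
      linarith
    have n2 : ‖q.2 / (1 + deriv φ q.1)‖ ≤ ‖q.2‖ / (1 - m) := by
      rw [norm_div]
      gcongr
    have n3 : ‖q.2 * F q‖ * (1 - m) ≤ ‖q.2‖ / (1 - m) := by linarith
    rw [sq, ← div_div, le_div_iff₀ hm']
    exact n3
  have hp' : |p.1.im| + ‖p.2‖ / (1 - m) ^ 2 < 1 := hp
  by_contra hcon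
  push Not at hcon
  obtain ⟨c, hc1, hc2⟩ := exists_between (show ‖p.2‖ / (1 - m) ^ 2 < 1 - |p.1.im| by linarith)
  have hcn : ∀ t ∈ Icc (0:ℝ) 1, ‖(t:ℂ)‖ ≤ 1 := by
    intro t ht
    rw [Complex.norm_real, Real.norm_of_nonneg ht.1]
    exact ht.2
  have hmem : ∀ t ∈ Icc (0:ℝ) 1, (p.1, (t:ℂ) * p.2) ∈ Dtri ((1 - m) ^ 2) := fun t ht =>
    aux_D_slice hlam hp (hcn t ht)
  have hcont : ContinuousOn (fun t : ℝ => ‖((t:ℂ) * p.2) * F (p.1, (t:ℂ) * p.2)‖)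
      (Icc (0:ℝ) 1) := by
    refine ContinuousOn.norm (ContinuousOn.mul (by fun_prop) ?_)
    exact hF.comp (f := fun t : ℝ => ((p.1, (t:ℂ) * p.2) : ℂ × ℂ)) (by fun_prop) hmem
  have hivt := intermediate_value_Icc (zero_le_one (α := ℝ)) hcont
  have hpos : 0 ≤ ‖p.2‖ / (1 - m) ^ 2 := by positivity
  obtain ⟨t, ht, hteq⟩ := hivt (show c ∈ Icc _ _ by
    refine ⟨?_, ?_⟩
    · simp; linarith
    · simp only [Complex.ofReal_one, one_mul]
      linarith)
  simp only at hteq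
  have hlt := step _ (hmem t ht) (by rw [hteq]; exact hc2)
  rw [hteq] at hlt
  have h3 : ‖(t:ℂ) * p.2‖ ≤ ‖p.2‖ := by
    rw [norm_mul]
    exact mul_le_of_le_one_left (norm_nonneg _) (hcn t ht)
  have h4 : ‖(t:ℂ) * p.2‖ / (1 - m) ^ 2 ≤ ‖p.2‖ / (1 - m) ^ 2 := by gcongr
  simp only at hlt
  linarith

open scoped Topology in
/-- divided equations, including on `y = 0` -/
lemma aux_divided {φ : ℂ → ℂ} (ha : AnalyticOnNhd ℂ φ (strip 1))
    (hb : ∀ z ∈ strip 1, ‖deriv φ z‖ ≤ 1 / 36) {F G : ℂ × ℂ → ℂ} {ω : ℝ} {lam : ℝ}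
    (hF : AnalyticOnNhd ℂ F (Dtri lam)) (hG : AnalyticOnNhd ℂ G (Dtri lam))
    (hap : ∀ p ∈ Dtri lam, ‖p.2 * F p‖ < 1 - |p.1.im|)
    (hE : ∀ p ∈ Dtri lam, p.2 * F p =
      p.2 / (1 + deriv φ p.1) + φ (p.1 + ω) - φ (p.1 + ω + p.2 * F p))
    (hE2 : ∀ p ∈ Dtri lam, p.2 * G p =
      (p.2 * F p + φ (p.1 + p.2 * F p) - φ p.1) * (1 + deriv φ (p.1 + ω + p.2 * F p)))
    {p : ℂ × ℂ} (hp : p ∈ Dtri lam) :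
    F p * (1 + deriv φ p.1) * (1 + auxQ (deriv φ) (p.1 + ω) (p.2 * F p)) = 1 ∧
    G p = F p * (1 + auxQ (deriv φ) p.1 (p.2 * F p)) * (1 + deriv φ (p.1 + ω + p.2 * F p)) := by
  have hlt := hap p hp
  obtain ⟨s1, s2, s3⟩ := aux_shift (z := p.1) (r := 1 - |p.1.im|) (by linarith) hlt ω
  have hp1 : p.1 ∈ strip 1 := by
    change |p.1.im| < 1
    have := norm_nonneg (p.2 * F p)
    linarith
  have hne : (1 + deriv φ p.1) ≠ 0 := by
    have := aux_one_add_lower (hb _ hp1)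
    intro h0
    rw [h0] at this
    norm_num at this
  have q1 := auxQ_mul ha s1 s3
  have q2 := auxQ_mul ha hp1 s2
  have E1 := hE p hp
  have E2 := hE2 p hp
  rcases eq_or_ne p.2 0 with hy | hy
  · -- differentiate in y at y = 0
    obtain ⟨x, y⟩ := p
    simp only at hy
    subst hy
    simp only [zero_mul, auxQ_zero, add_zero]
    simp only at hp1 hne s1
    have hev : ∀ᶠ s in 𝓝 (0:ℂ), (x, s) ∈ Dtri lam := by
      have hc : ContinuousAt (fun s : ℂ => ((x, s) : ℂ × ℂ)) 0 := by fun_prop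
      exact hc.eventually (aux_D_open.mem_nhds hp)
    have dl : DifferentiableAt ℂ (fun s : ℂ => ((x, s) : ℂ × ℂ)) 0 := by fun_prop
    have dF : DifferentiableAt ℂ (fun s : ℂ => F (x, s)) 0 :=
      DifferentiableAt.comp (g := F) (0:ℂ) (hF _ hp).differentiableAt dl
    have dG : DifferentiableAt ℂ (fun s : ℂ => G (x, s)) 0 :=
      DifferentiableAt.comp (g := G) (0:ℂ) (hG _ hp).differentiableAt dl
    have hsF : HasDerivAt (fun s : ℂ => s * F (x, s)) (F (x, 0)) 0 := by
      have : HasDerivAt (fun s : ℂ => s * F (x, s))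
          (1 * F (x, 0) + 0 * deriv (fun s => F (x, s)) 0) 0 :=
        (hasDerivAt_id (0:ℂ)).mul dF.hasDerivAt
      simpa using this
    have hsG : HasDerivAt (fun s : ℂ => s * G (x, s)) (G (x, 0)) 0 := by
      have : HasDerivAt (fun s : ℂ => s * G (x, s))
          (1 * G (x, 0) + 0 * deriv (fun s => G (x, s)) 0) 0 :=
        (hasDerivAt_id (0:ℂ)).mul dG.hasDerivAt
      simpa using this
    have comp : ∀ {g : ℂ → ℂ} {z : ℂ}, AnalyticAt ℂ g z →
        HasDerivAt (fun s : ℂ => g (z + s * F (x, s))) (deriv g z * F (x, 0)) 0 := by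
      intro g z hg
      have h2 : HasDerivAt (fun s : ℂ => z + s * F (x, s)) (F (x, 0)) 0 := hsF.const_add z
      exact HasDerivAt.comp (0:ℂ) (h₂ := g) (h := fun s : ℂ => z + s * F (x, s))
        (by simpa using hg.differentiableAt.hasDerivAt) h2
    have c1 := comp (ha _ s1)
    have c2 := comp (ha _ hp1)
    have c3 := comp (ha.deriv _ s1)
    constructor
    · have R : HasDerivAt (fun s : ℂ => s / (1 + deriv φ x) + φ (x + ω) -
          φ (x + ω + s * F (x, s))) (1 / (1 + deriv φ x) - deriv φ (x + ω) * F (x, 0)) 0 :=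
        (((hasDerivAt_id (0:ℂ)).div_const _).add_const _).sub c1
      have he : (fun s : ℂ => s * F (x, s)) =ᶠ[𝓝 0] fun s : ℂ => s / (1 + deriv φ x) +
          φ (x + ω) - φ (x + ω + s * F (x, s)) := by
        filter_upwards [hev] with s hs using hE _ hs
      have := hsF.unique (R.congr_of_eventuallyEq he)
      have k : F (x, 0) * (1 + deriv φ (x + ω)) = 1 / (1 + deriv φ x) := by
        linear_combination this
      calc F (x, 0) * (1 + deriv φ x) * (1 + deriv φ (x + ω))
          = (F (x, 0) * (1 + deriv φ (x + ω))) * (1 + deriv φ x) := by ring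
        _ = 1 := by rw [k]; field_simp
    · have R : HasDerivAt (fun s : ℂ => (s * F (x, s) + φ (x + s * F (x, s)) - φ x) *
          (1 + deriv φ (x + ω + s * F (x, s)))) _ 0 :=
        ((hsF.add c2).sub_const (φ x)).mul (c3.const_add 1)
      have he : (fun s : ℂ => s * G (x, s)) =ᶠ[𝓝 0] fun s : ℂ =>
          (s * F (x, s) + φ (x + s * F (x, s)) - φ x) *
          (1 + deriv φ (x + ω + s * F (x, s))) := by
        filter_upwards [hev] with s hs using hE2 _ hs
      have := hsG.unique (R.congr_of_eventuallyEq he)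
      rw [this]
      simp only [Pi.add_apply, zero_mul, add_zero, zero_add, sub_self]
      ring
  · constructor
    · have k : p.2 * F p * (1 + auxQ (deriv φ) (p.1 + ω) (p.2 * F p)) =
          p.2 / (1 + deriv φ p.1) := by
        linear_combination E1 + q1
      have k2 : p.2 * (F p * (1 + deriv φ p.1) * (1 + auxQ (deriv φ) (p.1 + ω) (p.2 * F p))) =
          p.2 * 1 := by
        calc _ = (p.2 * F p * (1 + auxQ (deriv φ) (p.1 + ω) (p.2 * F p))) * (1 + deriv φ p.1) := by
              ring
          _ = _ := by rw [k]; field_simp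
      exact mul_left_cancel₀ hy k2
    · refine mul_left_cancel₀ hy ?_
      rw [E2]
      linear_combination -(1 + deriv φ (p.1 + ω + p.2 * F p)) * q2

/-- **Corollary (`C²` bounds for `f̄`, `ḡ`).**  There is a universal constant `C` such
that `|f̄|^{(λ',2)} + |ḡ|^{(λ',2)} ≤ C` for `λ' = (1 − |φ'|)²/2` whenever
`‖φ'''‖₁ ≤ 1`. -/
theorem reduced_adapted_data_C2_bound :
    ∃ C : ℝ, 0 < C ∧
      ∀ (ω : ℝ) (φ : ℂ → ℂ),
        Per1 φ → AnalyticOnNhd ℂ φ (strip 1) → fwNormLE (deriv^[3] φ) 1 →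
        ∀ fb gb : ℂ × ℂ → ℂ,
          Per1' fb → Per1' gb →
          AnalyticOnNhd ℂ fb (Dtri ((1 - phiDerSup φ) ^ 2)) →
          AnalyticOnNhd ℂ gb (Dtri ((1 - phiDerSup φ) ^ 2)) →
          (∀ p ∈ Dtri ((1 - phiDerSup φ) ^ 2),
            p.2 + p.2 * fb p =
              p.2 / (1 + deriv φ p.1) + φ (p.1 + (ω : ℂ)) -
                φ (p.1 + (ω : ℂ) + p.2 + p.2 * fb p) ∧
            p.2 + p.2 * gb p =
              (p.2 + p.2 * fb p + φ (p.1 + p.2 + p.2 * fb p) - φ p.1) *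
                (1 + deriv φ (p.1 + (ω : ℂ) + p.2 + p.2 * fb p))) →
          triCr ((1 - phiDerSup φ) ^ 2 / 2) 2 fb +
              triCr ((1 - phiDerSup φ) ^ 2 / 2) 2 gb ≤
            ENNReal.ofReal C := by
  refine ⟨1700, by norm_num, ?_⟩
  intro ω φ hper ha hfw fb gb _ _ hfb hgb hEq
  obtain ⟨b1, b2, b3⟩ := aux_phi_bounds hper ha hfw
  set m := phiDerSup φ with hm
  have hbdd : BddAbove ((fun z => ‖deriv φ z‖) '' strip 1) := by
    refine ⟨1 / 36, ?_⟩
    rintro _ ⟨z, hz, rfl⟩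
    exact b1 z hz
  have hbm : ∀ z ∈ strip 1, ‖deriv φ z‖ ≤ m := fun z hz => le_csSup hbdd ⟨z, hz, rfl⟩
  have hm0 : 0 ≤ m := (norm_nonneg _).trans (hbm 0 (by simp [strip]))
  have hm1 : m ≤ 1 / 36 := by
    refine csSup_le ⟨_, ⟨0, by simp [strip], rfl⟩⟩ ?_
    rintro _ ⟨z, hz, rfl⟩
    exact b1 z hz
  have hlam : 0 < (1 - m) ^ 2 := by
    have : 0 < 1 - m := by linarith
    positivity
  have hlam1 : (1 - m) ^ 2 ≤ 1 := by nlinarith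
  set F : ℂ × ℂ → ℂ := fun p => 1 + fb p with hFdef
  set G : ℂ × ℂ → ℂ := fun p => 1 + gb p with hGdef
  have hF : AnalyticOnNhd ℂ F (Dtri ((1 - m) ^ 2)) := fun p hp => analyticAt_const.add (hfb p hp)
  have hG : AnalyticOnNhd ℂ G (Dtri ((1 - m) ^ 2)) := fun p hp => analyticAt_const.add (hgb p hp)
  have hr : ∀ (p : ℂ × ℂ), p.2 + p.2 * fb p = p.2 * F p := fun p => by simp only [hFdef]; ring
  have hr2 : ∀ (p : ℂ × ℂ), p.2 + p.2 * gb p = p.2 * G p := fun p => by simp only [hGdef]; ring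
  have hE1 : ∀ p ∈ Dtri ((1 - m) ^ 2), p.2 * F p =
      p.2 / (1 + deriv φ p.1) + φ (p.1 + ω) - φ (p.1 + ω + p.2 * F p) := by
    intro p hp
    have := (hEq p hp).1
    rw [add_assoc (p.1 + (ω:ℂ)), hr] at this
    exact this
  have hE2 : ∀ p ∈ Dtri ((1 - m) ^ 2), p.2 * G p =
      (p.2 * F p + φ (p.1 + p.2 * F p) - φ p.1) * (1 + deriv φ (p.1 + ω + p.2 * F p)) := by
    intro p hp
    have := (hEq p hp).2
    rw [add_assoc (p.1 + (ω:ℂ)), add_assoc p.1 p.2, hr, hr2] at this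
    exact this
  have hap : ∀ p ∈ Dtri ((1 - m) ^ 2), ‖p.2 * F p‖ < 1 - |p.1.im| := fun p hp =>
    aux_apriori ha (by linarith) hbm hF.continuousOn hE1 hp
  have hdiv := fun p (hp : p ∈ Dtri ((1 - m) ^ 2)) => aux_divided ha b1 hF hG hap hE1 hE2 hp
  have hcurve : ∀ p ∈ Dtri ((1 - m) ^ 2), ∀ α β : ℂ, ‖α‖ ≤ 1 → ‖β‖ ≤ 1 →
      AuxJ (fun s => F (p.1 + s * α, p.2 + s * β)) 2 1 40 ∧
      AuxJ (fun s => G (p.1 + s * α, p.2 + s * β)) 8 12 400 := by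
    intro p hp α β hα hβ
    have hp' : |p.1.im| + ‖p.2‖ / (1 - m) ^ 2 < 1 := hp
    have hpos : 0 ≤ ‖p.2‖ / (1 - m) ^ 2 := by positivity
    have hp1 : p.1 ∈ strip 1 := by
      change |p.1.im| < 1
      linarith
    have hp2 : ‖p.2‖ ≤ 1 := by
      have h1 : ‖p.2‖ / (1 - m) ^ 2 < 1 := by
        have := abs_nonneg p.1.im
        linarith
      rw [div_lt_one hlam] at h1
      linarith
    obtain ⟨s1, s2, s3⟩ := aux_shift (z := p.1) (r := 1 - |p.1.im|) (by linarith) (hap p hp) ω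
    have h0 : ((p.1 + 0 * α, p.2 + 0 * β) : ℂ × ℂ) = p := by simp
    have hl : AnalyticAt ℂ (fun s : ℂ => ((p.1 + s * α, p.2 + s * β) : ℂ × ℂ)) 0 := by fun_prop
    have hev : ∀ᶠ s in nhds (0:ℂ), (p.1 + s * α, p.2 + s * β) ∈ Dtri ((1 - m) ^ 2) :=
      hl.continuousAt.eventually (aux_D_open.mem_nhds (by beta_reduce; rw [h0]; exact hp))
    refine aux_curve ha b1 b2 b3 (x := p.1) (y := p.2) (α := α) (β := β) (w := ω) hα hβ hp2
      ?_ hp1 ?_ s1 ?_ ?_ ?_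
    · exact AnalyticAt.comp (g := F) (f := fun s : ℂ => ((p.1 + s * α, p.2 + s * β) : ℂ × ℂ))
        (by beta_reduce; rw [h0]; exact hF p hp) hl
    · beta_reduce; rw [h0]; exact s2
    · beta_reduce; rw [h0]; exact s3
    · filter_upwards [hev] with s hs
      have := (hdiv _ hs).1
      simp only at this
      rw [add_right_comm] at this
      exact this
    · filter_upwards [hev] with s hs
      have := (hdiv _ hs).2
      simp only at this
      rw [add_right_comm p.1 (s * α)] at this
      exact this
  have hsub : Dtri ((1 - m) ^ 2 / 2) ⊆ Dtri ((1 - m) ^ 2) := by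
    intro p hp
    have hp' : |p.1.im| + ‖p.2‖ / ((1 - m) ^ 2 / 2) < 1 := hp
    change |p.1.im| + ‖p.2‖ / (1 - m) ^ 2 < 1
    have : ‖p.2‖ / (1 - m) ^ 2 ≤ ‖p.2‖ / ((1 - m) ^ 2 / 2) := by
      gcongr
      linarith
    linarith
  have T1 : triCr ((1 - m) ^ 2 / 2) 2 fb ≤ ENNReal.ofReal (2 * 401) := by
    refine aux_triCr fun p hp j k hjk => ?_
    refine aux_partials (hfb p (hsub hp)) (fun α β hα hβ => ?_) hjk
    have := ((hcurve p (hsub hp) α β hα hβ).1.const_add (-1)).mono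
      (a' := 401) (b' := 401) (c' := 401) (by norm_num) (by norm_num) (by norm_num)
    simpa [hFdef] using this
  have T2 : triCr ((1 - m) ^ 2 / 2) 2 gb ≤ ENNReal.ofReal (2 * 401) := by
    refine aux_triCr fun p hp j k hjk => ?_
    refine aux_partials (hgb p (hsub hp)) (fun α β hα hβ => ?_) hjk
    have := ((hcurve p (hsub hp) α β hα hβ).2.const_add (-1)).mono
      (a' := 401) (b' := 401) (c' := 401) (by norm_num) (by norm_num) (by norm_num)
    simpa [hGdef] using this
  calc _ ≤ ENNReal.ofReal (2 * 401) + ENNReal.ofReal (2 * 401) := add_le_add T1 T2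
    _ = ENNReal.ofReal (2 * 401 + 2 * 401) := (ENNReal.ofReal_add (by norm_num) (by norm_num)).symm
    _ ≤ _ := ENNReal.ofReal_le_ofReal (by norm_num)

end
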